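/- arXiv:2008.10473 — 3 statements merged into one kernel-verified Lean document; each statement's English description precedes it below -/
import Mathlib

section
/- Deterministic maximal selection principle: for every f ∈ H²(𝔻) there exists a ∈ 𝔻 attaining the supremum |⟨f, e_a⟩| = sup{ |⟨f, e_b⟩| : b ∈ 𝔻 }, where ⟨f, e_b⟩ = √(1−|b|²)·f(b). -/
noncomputable section

open Filter Topology

theorem summable_mul_pow_of_summable_sq {a : ℕ → ℝ}
    (ha : Summable fun k => a k ^ 2) {t : ℝ} (ht0 : 0 ≤ t) (ht : t < 1) :
    Summable fun k => a k * t ^ k := by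
  have hg : Summable fun k : ℕ => (t ^ 2) ^ k :=
    summable_geometric_of_lt_one (by positivity) (by nlinarith)
  refine Summable.of_norm_bounded (ha.add hg) fun k => ?_
  rw [← pow_mul, mul_comm 2 k, pow_mul, Real.norm_eq_abs, abs_le]
  constructor <;> nlinarith [sq_nonneg (a k + t ^ k), sq_nonneg (a k - t ^ k),
    sq_nonneg (a k), sq_nonneg (t ^ k)]

theorem summable_mul_pow_complex {a : ℕ → ℂ} (ha : Summable fun k => ‖a k‖ ^ 2)
    {b : ℂ} (hb : ‖b‖ < 1) : Summable fun k => a k * b ^ k := by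
  refine Summable.of_norm ?_
  simpa only [norm_mul, norm_pow] using
    summable_mul_pow_of_summable_sq ha (norm_nonneg b) hb

theorem sqrt_mul_norm_tsum_le {a : ℕ → ℂ} (ha : Summable fun k => ‖a k‖ ^ 2)
    {ε : ℝ} (hε : 0 < ε) (haε : ∑' k, ‖a k‖ ^ 2 ≤ ε ^ 2) {b : ℂ} (hb : ‖b‖ < 1) :
    Real.sqrt (1 - ‖b‖ ^ 2) * ‖∑' k, a k * b ^ k‖ ≤ ε := by
  set s := Real.sqrt (1 - ‖b‖ ^ 2)
  have hpos : 0 < 1 - ‖b‖ ^ 2 := by nlinarith [norm_nonneg b]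
  have hs2 : s ^ 2 = 1 - ‖b‖ ^ 2 := Real.sq_sqrt hpos.le
  have hsum := summable_mul_pow_of_summable_sq ha (norm_nonneg b) hb
  have hgeo : HasSum (fun k : ℕ => (‖b‖ ^ 2) ^ k) (1 - ‖b‖ ^ 2)⁻¹ :=
    hasSum_geometric_of_lt_one (by positivity) (by linarith)
  have hnorm : ‖∑' k, a k * b ^ k‖ ≤ ∑' k, ‖a k‖ * ‖b‖ ^ k := by
    have := norm_tsum_le_tsum_norm (f := fun k => a k * b ^ k)
      (by simpa only [norm_mul, norm_pow] using hsum)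
    simpa only [norm_mul, norm_pow] using this
  have hle : 2 * ε * s * ∑' k, ‖a k‖ * ‖b‖ ^ k
      ≤ ∑' k, ‖a k‖ ^ 2 + ε ^ 2 * s ^ 2 * (1 - ‖b‖ ^ 2)⁻¹ := by
    refine hasSum_le (fun k => ?_) (hsum.hasSum.mul_left (2 * ε * s))
      (ha.hasSum.add (hgeo.mul_left (ε ^ 2 * s ^ 2)))
    have : (‖b‖ ^ 2) ^ k = (‖b‖ ^ k) ^ 2 := by ring
    simp only [this]
    nlinarith [sq_nonneg (‖a k‖ - ε * s * ‖b‖ ^ k)]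
  rw [hs2, mul_assoc (ε ^ 2), mul_inv_cancel₀ hpos.ne', mul_one] at hle
  have h1 : s * ‖∑' k, a k * b ^ k‖ ≤ s * ∑' k, ‖a k‖ * ‖b‖ ^ k :=
    mul_le_mul_of_nonneg_left hnorm (Real.sqrt_nonneg _)
  refine h1.trans (le_of_mul_le_mul_left (a := 2 * ε) ?_ (by positivity))
  nlinarith

theorem continuousOn_tsum_mul_pow {a : ℕ → ℂ} (ha : Summable fun k => ‖a k‖ ^ 2)
    {r : ℝ} (hr0 : 0 ≤ r) (hr : r < 1) :
    ContinuousOn (fun b : ℂ => ∑' k, a k * b ^ k) (Metric.closedBall 0 r) := by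
  refine continuousOn_tsum (fun k => by fun_prop)
    (summable_mul_pow_of_summable_sq ha hr0 hr) fun k b hb => ?_
  rw [mem_closedBall_zero_iff] at hb
  rw [norm_mul, norm_pow]
  gcongr

/-- The quantity `√(1 - |b|²) |f(b)|` vanishes uniformly at the unit circle. -/
theorem exists_radius_sqrt_mul_norm_tsum_le {a : ℕ → ℂ}
    (ha : Summable fun k => ‖a k‖ ^ 2) {m : ℝ} (hm : 0 < m) :
    ∃ r < 1, ∀ b : ℂ, r < ‖b‖ → ‖b‖ < 1 →
      Real.sqrt (1 - ‖b‖ ^ 2) * ‖∑' k, a k * b ^ k‖ ≤ m := by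
  obtain ⟨N, hN⟩ : ∃ N, ∑' k, ‖a (k + N)‖ ^ 2 < (m / 2) ^ 2 :=
    ((tendsto_sum_nat_add fun k => ‖a k‖ ^ 2).eventually
      (gt_mem_nhds (by positivity))).exists
  set C := ∑ k ∈ Finset.range N, ‖a k‖
  have hC0 : 0 ≤ C := Finset.sum_nonneg fun _ _ => norm_nonneg _
  have hlim : Tendsto (fun t : ℝ => Real.sqrt (1 - t ^ 2) * C) (𝓝[<] 1) (𝓝 0) := by
    have : Continuous fun t : ℝ => Real.sqrt (1 - t ^ 2) * C := by fun_prop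
    simpa using (this.tendsto 1).mono_left nhdsWithin_le_nhds
  obtain ⟨r, hr, hrC⟩ := (mem_nhdsLT_iff_exists_Ioo_subset).1
    (hlim.eventually (gt_mem_nhds (half_pos hm)))
  refine ⟨r, hr, fun b hrb hb => ?_⟩
  have hhead : ‖∑ k ∈ Finset.range N, a k * b ^ k‖ ≤ C := by
    refine norm_sum_le_of_le _ fun k _ => ?_
    rw [norm_mul, norm_pow]
    exact mul_le_of_le_one_right (norm_nonneg _) (pow_le_one₀ (norm_nonneg _) hb.le)
  have htail := sqrt_mul_norm_tsum_le ((summable_nat_add_iff N).2 ha)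
    (half_pos hm) hN.le hb
  have hsplit : ∑' k, a k * b ^ k
      = ∑ k ∈ Finset.range N, a k * b ^ k + b ^ N * ∑' k, a (k + N) * b ^ k := by
    rw [← (summable_mul_pow_complex ha hb).sum_add_tsum_nat_add N, ← tsum_mul_left]
    congr 2
    ext k
    ring
  have hnorm : ‖∑' k, a k * b ^ k‖ ≤ C + ‖∑' k, a (k + N) * b ^ k‖ := by
    rw [hsplit]
    refine (norm_add_le _ _).trans (add_le_add hhead ?_)
    rw [norm_mul, norm_pow]
    exact mul_le_of_le_one_left (norm_nonneg _) (pow_le_one₀ (norm_nonneg _) hb.le)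
  have hbC : Real.sqrt (1 - ‖b‖ ^ 2) * C < m / 2 := hrC ⟨hrb, hb⟩
  have := mul_le_mul_of_nonneg_left hnorm (Real.sqrt_nonneg (1 - ‖b‖ ^ 2))
  linarith

/-- Deterministic maximal selection principle: for every `f ∈ H²(𝔻)`
(identified with `ℓ²(ℕ)`), there exists `a ∈ 𝔻` attaining the supremum of
`b ↦ |⟨f, e_b⟩| = √(1−|b|²)·|f(b)|` over the unit disc. -/
theorem statement9 (c : lp (fun _ : ℕ => ℂ) 2) :
    ∃ a : ℂ, ‖a‖ < 1 ∧
      ∀ b : ℂ, ‖b‖ < 1 →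
        Real.sqrt (1 - ‖b‖ ^ 2) * ‖∑' k : ℕ, c k * b ^ k‖
          ≤ Real.sqrt (1 - ‖a‖ ^ 2) * ‖∑' k : ℕ, c k * a ^ k‖ := by
  have hc : Summable fun k => ‖c k‖ ^ 2 := by
    simpa using (memℓp_gen_iff (p := 2) (by norm_num)).1 (lp.memℓp c)
  by_cases h : ∃ b : ℂ, ‖b‖ < 1 ∧
      0 < Real.sqrt (1 - ‖b‖ ^ 2) * ‖∑' k : ℕ, c k * b ^ k‖
  · obtain ⟨b₀, hb₀, hpos⟩ := h
    obtain ⟨r, hr, hrm⟩ := exists_radius_sqrt_mul_norm_tsum_le hc hpos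
    have hR : max r ‖b₀‖ < 1 := max_lt hr hb₀
    have hb₀R : b₀ ∈ Metric.closedBall (0 : ℂ) (max r ‖b₀‖) := by simp
    have hcont : ContinuousOn
        (fun b : ℂ => Real.sqrt (1 - ‖b‖ ^ 2) * ‖∑' k : ℕ, c k * b ^ k‖)
        (Metric.closedBall 0 (max r ‖b₀‖)) :=
      ContinuousOn.mul (by fun_prop)
        (continuousOn_tsum_mul_pow hc ((norm_nonneg b₀).trans (le_max_right _ _)) hR).norm
    obtain ⟨a, ha, hmax⟩ :=
      (isCompact_closedBall (0 : ℂ) (max r ‖b₀‖)).exists_isMaxOn ⟨b₀, hb₀R⟩ hcont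
    refine ⟨a, (mem_closedBall_zero_iff.1 ha).trans_lt hR, fun b hb => ?_⟩
    by_cases hbR : ‖b‖ ≤ max r ‖b₀‖
    · exact hmax (mem_closedBall_zero_iff.2 hbR)
    · exact (hrm b ((le_max_left _ _).trans_lt (not_le.1 hbR)) hb).trans (hmax hb₀R)
  · push Not at h
    exact ⟨0, by simp, fun b hb => (h b hb).trans (by positivity)⟩
end
end

section
/- One-step AFD energy decomposition: let f ∈ H²(𝔻) and a ∈ 𝔻. Then the function f₂(z) = (f(z) − ⟨f, e_a⟩·e_a(z))·(1 − conj(a)z)/(z − a), defined for z ∈ 𝔻 \ {a}, extends to an analytic function on 𝔻 belonging to H²(𝔻), and there holds the Pythagorean identity ‖f‖²_{H²} = |⟨f, e_a⟩|² + ‖f₂‖²_{H²}, where ⟨f, e_a⟩ = √(1−|a|²)·f(a). -/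
open scoped ComplexConjugate

noncomputable section

/-- The value at `a` of the `n`-fold backward shift of the power series with coefficients `c`. -/
def tailSum (c : ℕ → ℂ) (a : ℂ) (n : ℕ) : ℂ := ∑' k : ℕ, c (n + k) * a ^ k

lemma summable_mul_pow_of_bounded {c : ℕ → ℂ} {M : ℝ} (hc : ∀ n, ‖c n‖ ≤ M) {z : ℂ}
    (hz : ‖z‖ < 1) : Summable fun n => c n * z ^ n := by
  refine Summable.of_norm_bounded
    ((summable_geometric_of_lt_one (norm_nonneg z) hz).mul_left M) fun n => ?_
  rw [norm_mul, norm_pow]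
  exact mul_le_mul_of_nonneg_right (hc n) (by positivity)

lemma tailSum_eq_add {c : ℕ → ℂ} {M : ℝ} (hc : ∀ n, ‖c n‖ ≤ M) {a : ℂ} (ha : ‖a‖ < 1) (n : ℕ) :
    tailSum c a n = c n + a * tailSum c a (n + 1) := by
  have h := summable_mul_pow_of_bounded (c := fun k => c (n + k)) (fun k => hc (n + k)) ha
  rw [tailSum, h.tsum_eq_zero_add, tailSum, ← tsum_mul_left]
  simp only [add_zero, pow_zero, mul_one]
  congr 1
  refine tsum_congr fun k => ?_
  rw [show n + (k + 1) = n + 1 + k by ring]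
  ring

lemma tendsto_tailSum {c : ℕ → ℂ} {M : ℝ} (hc : ∀ n, ‖c n‖ ≤ M)
    (hc0 : Filter.Tendsto c Filter.atTop (nhds 0)) {a : ℂ} (ha : ‖a‖ < 1) :
    Filter.Tendsto (tailSum c a) Filter.atTop (nhds 0) := by
  have h := tendsto_tsum_of_dominated_convergence (𝓕 := Filter.atTop)
    (f := fun n k => c (n + k) * a ^ k) (g := fun _ => (0 : ℂ)) (bound := fun k => M * ‖a‖ ^ k)
    ((summable_geometric_of_lt_one (norm_nonneg a) ha).mul_left M)
    (fun k => by
      simpa using (hc0.comp (Filter.tendsto_add_atTop_nat k)).mul_const (a ^ k))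
    (Filter.Eventually.of_forall fun n k => by
      rw [norm_mul, norm_pow]
      exact mul_le_mul_of_nonneg_right (hc _) (by positivity))
  rwa [tsum_zero] at h

lemma norm_sq_sub_conj_mul (a s t : ℂ) :
    ‖t - conj a * s‖ ^ 2 = ‖s - a * t‖ ^ 2 - (1 - ‖a‖ ^ 2) * (‖s‖ ^ 2 - ‖t‖ ^ 2) := by
  simp only [← Complex.normSq_eq_norm_sq, Complex.normSq_apply, Complex.sub_re, Complex.sub_im,
    Complex.mul_re, Complex.mul_im, Complex.conj_re, Complex.conj_im]
  ring

/-- One-step AFD energy decomposition: for `f ∈ H²(𝔻)` (identified with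
`c ∈ ℓ²(ℕ)`) and `a ∈ 𝔻`, the reduced remainder
`f₂(z) = (f(z) − ⟨f,e_a⟩ e_a(z))·(1 − conj(a) z)/(z − a)` extends to a function in `H²(𝔻)`
(i.e. there is `d ∈ ℓ²(ℕ)` whose power series agrees with it on `𝔻 \ {a}`), and the
Pythagorean identity `‖f‖² = |⟨f,e_a⟩|² + ‖f₂‖²` holds, where
`⟨f,e_a⟩ = √(1−|a|²) f(a)`. -/
theorem statement10 (c : lp (fun _ : ℕ => ℂ) 2) (a : ℂ) (ha : ‖a‖ < 1) :
    ∃ d : lp (fun _ : ℕ => ℂ) 2,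
      (∀ z : ℂ, ‖z‖ < 1 → z ≠ a →
        (∑' k : ℕ, d k * z ^ k)
          = ((∑' k : ℕ, c k * z ^ k)
              - ((Real.sqrt (1 - ‖a‖ ^ 2) : ℂ) * ∑' k : ℕ, c k * a ^ k)
                * ((Real.sqrt (1 - ‖a‖ ^ 2) : ℂ) / (1 - conj a * z)))
            * (1 - conj a * z) / (z - a)) ∧
      ‖c‖ ^ 2
        = ‖(Real.sqrt (1 - ‖a‖ ^ 2) : ℂ) * ∑' k : ℕ, c k * a ^ k‖ ^ 2 + ‖d‖ ^ 2 := by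
  have hp : 0 < (2 : ENNReal).toReal := by norm_num
  have hM : ∀ n, ‖c n‖ ≤ ‖c‖ := fun n => lp.norm_apply_le_norm (by norm_num) c n
  have hcs : HasSum (fun n => ‖c n‖ ^ 2) (‖c‖ ^ 2) := by
    simpa using lp.hasSum_norm hp c
  have hc0 : Filter.Tendsto (fun n => c n) Filter.atTop (nhds 0) := by
    rw [tendsto_zero_iff_norm_tendsto_zero]
    simpa [Real.sqrt_sq] using hcs.summable.tendsto_atTop_zero.sqrt
  set t := tailSum (fun n => c n) a with ht
  have hrec : ∀ n, t n = c n + a * t (n + 1) := tailSum_eq_add hM ha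
  have ht0 : Filter.Tendsto t Filter.atTop (nhds 0) := tendsto_tailSum hM hc0 ha
  have hfa : ∑' k : ℕ, c k * a ^ k = t 0 := by simp [ht, tailSum]
  have hpos : 0 ≤ 1 - ‖a‖ ^ 2 := by nlinarith [norm_nonneg a]
  have hnorm : ∀ n, ‖t (n + 1) - conj a * t n‖ ^ 2
      = ‖c n‖ ^ 2 - (1 - ‖a‖ ^ 2) * (‖t n‖ ^ 2 - ‖t (n + 1)‖ ^ 2) := fun n => by
    rw [norm_sq_sub_conj_mul, show t n - a * t (n + 1) = c n by rw [hrec n]; ring]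
  have hds : HasSum (fun n => ‖t (n + 1) - conj a * t n‖ ^ 2)
      (‖c‖ ^ 2 - (1 - ‖a‖ ^ 2) * ‖t 0‖ ^ 2) := by
    rw [hasSum_iff_tendsto_nat_of_nonneg fun n => by positivity]
    have hsum : ∀ N, ∑ n ∈ Finset.range N, ‖t (n + 1) - conj a * t n‖ ^ 2
        = ∑ n ∈ Finset.range N, ‖c n‖ ^ 2 - (1 - ‖a‖ ^ 2) * (‖t 0‖ ^ 2 - ‖t N‖ ^ 2) := fun N => by
      simp_rw [hnorm, Finset.sum_sub_distrib, ← Finset.mul_sum,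
        Finset.sum_range_sub' (fun n => ‖t n‖ ^ 2)]
    simp_rw [hsum]
    simpa using hcs.tendsto_sum_nat.sub
      (((ht0.norm.pow 2).const_sub (‖t 0‖ ^ 2)).const_mul (1 - ‖a‖ ^ 2))
  let d : lp (fun _ : ℕ => ℂ) 2 :=
    ⟨fun n => t (n + 1) - conj a * t n, memℓp_gen (by simpa using hds.summable)⟩
  have hd : ∀ n, d n = t (n + 1) - conj a * t n := fun _ => rfl
  refine ⟨d, fun z hz hza => ?_, ?_⟩
  · obtain ⟨B, hB⟩ := ht0.norm.bddAbove_range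
    have htB : ∀ n, ‖t n‖ ≤ B := fun n => hB ⟨n, rfl⟩
    have hT := summable_mul_pow_of_bounded htB hz
    have hG := summable_mul_pow_of_bounded (fun n => htB (n + 1)) hz
    have hTG : ∑' n, t n * z ^ n = t 0 + z * ∑' n, t (n + 1) * z ^ n := by
      rw [hT.tsum_eq_zero_add, ← tsum_mul_left]
      simp only [pow_zero, mul_one, pow_succ', mul_left_comm]
    have hf : ∑' n, c n * z ^ n = t 0 + (z - a) * ∑' n, t (n + 1) * z ^ n := by
      have h := (hT.hasSum.sub (hG.hasSum.mul_left a)).tsum_eq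
      rw [hTG] at h
      rw [sub_mul, add_sub, ← h]
      refine tsum_congr fun n => ?_
      rw [hrec n]
      ring
    have hD : ∑' n, d n * z ^ n = ∑' n, t (n + 1) * z ^ n - conj a * ∑' n, t n * z ^ n := by
      rw [← (hG.hasSum.sub (hT.hasSum.mul_left (conj a))).tsum_eq]
      refine tsum_congr fun n => ?_
      rw [hd n]
      ring
    have hs : (Real.sqrt (1 - ‖a‖ ^ 2) : ℂ) * (Real.sqrt (1 - ‖a‖ ^ 2) : ℂ) = 1 - conj a * a := by
      rw [← Complex.ofReal_mul, Real.mul_self_sqrt hpos, Complex.conj_mul']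
      push_cast
      rfl
    have hne : 1 - conj a * z ≠ 0 := by
      intro h
      have h1 : ‖conj a * z‖ = 1 := by rw [← sub_eq_zero.mp h, norm_one]
      rw [norm_mul, RCLike.norm_conj] at h1
      nlinarith [norm_nonneg a, norm_nonneg z]
    rw [hD, hTG, hf, hfa, eq_div_iff (sub_ne_zero.mpr hza)]
    linear_combination (Real.sqrt (1 - ‖a‖ ^ 2) : ℂ) * t 0
      * div_mul_cancel₀ (Real.sqrt (1 - ‖a‖ ^ 2) : ℂ) hne + t 0 * hs
  · have hdn : ‖d‖ ^ 2 = ‖c‖ ^ 2 - (1 - ‖a‖ ^ 2) * ‖t 0‖ ^ 2 := by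
      have h := lp.hasSum_norm hp d
      simp only [hd, ENNReal.toReal_ofNat, Real.rpow_ofNat] at h
      exact h.unique hds
    rw [hdn, hfa, norm_mul, mul_pow, Complex.norm_real, Real.norm_eq_abs, sq_abs,
      Real.sq_sqrt hpos]
    ring
end
end

section
/- Identity (5.65): let a₁, …, a_{m−1} ∈ 𝔻 (repetitions allowed) with associated Takenaka–Malmquist system B₁, …, B_{m−1}, and let a ∈ 𝔻 be different from each a_l. Let k_a(z) = 1/(1−conj(a)z) be the Szegő kernel and φ(z) = ∏_{l=1}^{m−1} (z−a_l)/(1−conj(a_l)z) the canonical Blaschke product. Then, as elements of L²(∂𝔻), k_a − ∑_{l=1}^{m−1} ⟨k_a, B_l⟩ B_l = conj(φ(a))·φ·k_a, i.e. for a.e. t, k_a(e^{it}) − ∑_{l=1}^{m−1} ⟨k_a, B_l⟩ B_l(e^{it}) = conj(φ(a))·φ(e^{it})·k_a(e^{it}). -/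
open scoped ComplexConjugate

noncomputable section

/-- The Szegő kernel `k_b(z) = 1/(1 − conj(b)z)` evaluated at `z = e^{it}`. -/
def szego (b : ℂ) (t : ℝ) : ℂ := 1 / (1 - conj b * Complex.exp (Complex.I * t))

/-- The Takenaka–Malmquist system associated with `a₁, a₂, … ∈ 𝔻` (0-indexed:
`TMfun a l` is `B_{l+1}`), evaluated at `z = e^{it}`. -/
def TMfun (a : ℕ → ℂ) (l : ℕ) (t : ℝ) : ℂ :=
  ((Real.sqrt (1 - ‖a l‖ ^ 2) : ℂ) / (1 - conj (a l) * Complex.exp (Complex.I * t))) *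
    ∏ j ∈ Finset.range l,
      (Complex.exp (Complex.I * t) - a j) / (1 - conj (a j) * Complex.exp (Complex.I * t))

/-- The canonical Blaschke product `φ(z) = ∏_{l<m} (z−a_l)/(1−conj(a_l)z)`. -/
def blaschke (a : ℕ → ℂ) (m : ℕ) (z : ℂ) : ℂ :=
  ∏ l ∈ Finset.range m, (z - a l) / (1 - conj (a l) * z)

/-- The Takenaka–Malmquist function `B_{l+1}` as a function of `z ∈ ℂ`. -/
def takenakaMalmquist (a : ℕ → ℂ) (l : ℕ) (z : ℂ) : ℂ :=
  ((Real.sqrt (1 - ‖a l‖ ^ 2) : ℂ) / (1 - conj (a l) * z)) * blaschke a l z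

theorem TMfun_eq_takenakaMalmquist (a : ℕ → ℂ) (l : ℕ) (t : ℝ) :
    TMfun a l t = takenakaMalmquist a l (Complex.exp (Complex.I * t)) := rfl

theorem one_sub_conj_mul_ne_zero {a z : ℂ} (ha : ‖a‖ < 1) (hz : ‖z‖ ≤ 1) :
    1 - conj a * z ≠ 0 := by
  intro h
  have h1 : ‖conj a * z‖ = 1 := by rw [← sub_eq_zero.1 h, norm_one]
  rw [norm_mul, RCLike.norm_conj] at h1
  nlinarith [norm_nonneg a, norm_nonneg z]

theorem differentiableOn_takenakaMalmquist (a : ℕ → ℂ) (l : ℕ) (ha : ∀ j ≤ l, ‖a j‖ < 1) :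
    DifferentiableOn ℂ (takenakaMalmquist a l) (Metric.closedBall 0 1) := by
  have hne : ∀ j ≤ l, ∀ z ∈ Metric.closedBall (0 : ℂ) 1, 1 - conj (a j) * z ≠ 0 :=
    fun j hj z hz => one_sub_conj_mul_ne_zero (ha j hj) (by simpa using hz)
  refine DifferentiableOn.mul (DifferentiableOn.div (by fun_prop) (by fun_prop) (hne l le_rfl)) ?_
  unfold blaschke
  refine DifferentiableOn.fun_finsetProd fun j hj => ?_
  exact DifferentiableOn.div (by fun_prop) (by fun_prop) (hne j (Finset.mem_range.1 hj).le)

theorem norm_exp_I_mul (t : ℝ) : ‖Complex.exp (Complex.I * t)‖ = 1 := by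
  rw [mul_comm, Complex.norm_exp_ofReal_mul_I]

/-- The reproducing property of the Szegő kernel. -/
theorem integral_mul_conj_szego {F : ℂ → ℂ} (hF : DifferentiableOn ℂ F (Metric.closedBall 0 1))
    {b : ℂ} (hb : ‖b‖ < 1) :
    ((1 / (2 * Real.pi) : ℝ) : ℂ) *
      ∫ s in (0 : ℝ)..(2 * Real.pi), F (Complex.exp (Complex.I * s)) * conj (szego b s) = F b := by
  have hcauchy := hF.circleIntegral_sub_inv_smul (w := b) (by simpa using hb)
  have hint : (∮ z in C(0, 1), (z - b)⁻¹ • F z) = Complex.I *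
      ∫ s in (0 : ℝ)..(2 * Real.pi), F (Complex.exp (Complex.I * s)) * conj (szego b s) := by
    rw [circleIntegral, ← intervalIntegral.integral_const_mul]
    refine intervalIntegral.integral_congr fun s _ => ?_
    have hz := norm_exp_I_mul s
    have hcm : circleMap 0 1 s = Complex.exp (Complex.I * s) := by
      simp [circleMap, mul_comm]
    simp only [deriv_circleMap, hcm, smul_eq_mul, szego]
    set z := Complex.exp (Complex.I * s)
    have hzz : z * conj z = 1 := by
      rw [Complex.mul_conj, Complex.normSq_eq_norm_sq, hz]; simp
    have hzb : z - b ≠ 0 := by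
      intro h
      rw [sub_eq_zero.1 h] at hz
      linarith
    have h1 : 1 - b * conj z ≠ 0 := by
      intro h
      apply hzb
      linear_combination z * h + b * hzz
    simp only [map_div₀, map_one, map_sub, map_mul, Complex.conj_conj]
    field_simp
    linear_combination (-b * F z) * hzz
  rw [hint, smul_eq_mul] at hcauchy
  have hpi : (Real.pi : ℂ) ≠ 0 := by exact_mod_cast Real.pi_ne_zero
  have hcancel := mul_left_cancel₀ Complex.I_ne_zero
    (hcauchy.trans (by ring : _ = Complex.I * (2 * Real.pi * F b)))
  rw [hcancel]
  push_cast
  field_simp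

theorem inner_szego_TMfun (a : ℕ → ℂ) (l : ℕ) (ha : ∀ j ≤ l, ‖a j‖ < 1) {b : ℂ} (hb : ‖b‖ < 1) :
    ((1 / (2 * Real.pi) : ℝ) : ℂ) *
      ∫ s in (0 : ℝ)..(2 * Real.pi), szego b s * conj (TMfun a l s)
      = conj (takenakaMalmquist a l b) := by
  rw [← integral_mul_conj_szego (differentiableOn_takenakaMalmquist a l ha) hb, map_mul,
    Complex.conj_ofReal, ← intervalIntegral.intervalIntegral_conj]
  congr 1
  refine intervalIntegral.integral_congr fun s _ => ?_
  simp [TMfun_eq_takenakaMalmquist, mul_comm]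

/-- The Christoffel–Darboux formula for the Takenaka–Malmquist system. -/
theorem szego_sub_sum_takenakaMalmquist (m : ℕ) (a : ℕ → ℂ) (ha : ∀ l < m, ‖a l‖ < 1)
    {b z : ℂ} (hb : ‖b‖ < 1) (hz : ‖z‖ ≤ 1) :
    1 / (1 - conj b * z)
        - ∑ l ∈ Finset.range m, conj (takenakaMalmquist a l b) * takenakaMalmquist a l z
      = conj (blaschke a m b) * blaschke a m z * (1 / (1 - conj b * z)) := by
  induction m with
  | zero => simp [blaschke]
  | succ m ih =>
    have ham := ha m m.lt_succ_self
    rw [Finset.sum_range_succ, ← sub_sub, ih fun l hl => ha l (hl.trans m.lt_succ_self)]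
    have hb_succ : ∀ w, blaschke a (m + 1) w
        = blaschke a m w * ((w - a m) / (1 - conj (a m) * w)) :=
      fun w => Finset.prod_range_succ _ _
    have hbz := one_sub_conj_mul_ne_zero hb hz
    have haz := one_sub_conj_mul_ne_zero ham hz
    have hab := one_sub_conj_mul_ne_zero hb ham.le
    have hsqrt : (Real.sqrt (1 - ‖a m‖ ^ 2) : ℂ) ^ 2 = 1 - a m * conj (a m) := by
      rw [← Complex.ofReal_pow, Real.sq_sqrt (by nlinarith [norm_nonneg (a m)]),
        Complex.mul_conj, Complex.normSq_eq_norm_sq]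
      push_cast
      rfl
    rw [hb_succ, hb_succ]
    simp only [takenakaMalmquist, map_mul, map_div₀, map_sub, map_one, Complex.conj_conj,
      Complex.conj_ofReal]
    generalize (Real.sqrt (1 - ‖a m‖ ^ 2) : ℂ) = r at hsqrt
    generalize conj (blaschke a m b) = p
    generalize conj b = c at hbz hab ⊢
    generalize conj (a m) = d at haz hsqrt ⊢
    generalize a m = e at hab hsqrt ⊢
    generalize blaschke a m z = q
    rw [mul_comm d z] at haz ⊢
    rw [mul_comm e c]
    field_simp
    linear_combination (-p * q * (1 - c * z)) * hsqrt

/-- (Identity (5.65).) For `a₁, …, a_{m−1} ∈ 𝔻` with TM system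
`B₁, …, B_{m−1}` and `b ∈ 𝔻` different from each `a_l`,
`k_b − ∑_{l<m} ⟨k_b, B_l⟩ B_l = conj(φ(b))·φ·k_b` on the circle, where
`⟨f,g⟩ = (1/2π)∫₀^{2π} f(e^{is})·conj(g(e^{is})) ds`. -/
theorem statement17 (m : ℕ) (a : ℕ → ℂ) (ha : ∀ l < m, ‖a l‖ < 1)
    (b : ℂ) (hb : ‖b‖ < 1) (hb' : ∀ l < m, b ≠ a l) :
    ∀ t : ℝ,
      szego b t
          - ∑ l ∈ Finset.range m,
              (((1 / (2 * Real.pi) : ℝ) : ℂ)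
                  * ∫ s in (0 : ℝ)..(2 * Real.pi), szego b s * conj (TMfun a l s))
                * TMfun a l t
        = conj (blaschke a m b) * blaschke a m (Complex.exp (Complex.I * t)) * szego b t := by
  intro t
  rw [Finset.sum_congr rfl fun l hl => by
    rw [inner_szego_TMfun a l
      (fun j hj => ha j (hj.trans_lt (Finset.mem_range.1 hl))) hb, TMfun_eq_takenakaMalmquist]]
  exact szego_sub_sum_takenakaMalmquist m a ha hb (norm_exp_I_mul t).le
end
end
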